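/- Let a, b ∈ ℝ. The endpoint map F : ℝ⁴ → ℝ⁴, F(p) = γ_p(1), has polynomial components in p = (c,d₁,d₂,d₃); it satisfies F(0,0,0,0) = (a, b, ab/2, a²b/6); its Jacobian matrix at (0,0,0,0) equals the 4×4 matrix with rows (1/2, 0, 0, 0), (0, 1/2, 1/3, 1/4), (b/6, a/3, a/4, a/5), (ab/8, a²/8, a²/10, a²/12); and the determinant of this matrix equals a³/172800. In particular, the Jacobian of F at 0 is invertible if and only if a ≠ 0. -/

import Mathlib

open MeasureTheory Set

/-- The curve `γ_p : [0,1] → ℝ⁴` with parameter `p = (c,d₁,d₂,d₃)` used in the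
pliability argument in the Engel group: `γ_p(0) = 0`,
`γ_{p,1}' = a + ct`, `γ_{p,2}' = b + d₁t + d₂t² + d₃t³`,
`γ_{p,3}' = γ_{p,2}'·γ_{p,1}` and `γ_{p,4}' = (1/2)·γ_{p,2}'·γ_{p,1}²`. -/
def IsEngelPolyCurve (a b : ℝ) (p : Fin 4 → ℝ) (γ : ℝ → Fin 4 → ℝ) : Prop :=
  (γ 0 = fun _ => 0) ∧
  ∀ t ∈ Icc (0:ℝ) 1,
    HasDerivWithinAt (fun s => γ s 0) (a + p 0 * t) (Icc (0:ℝ) 1) t ∧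
    HasDerivWithinAt (fun s => γ s 1)
      (b + p 1 * t + p 2 * t^2 + p 3 * t^3) (Icc (0:ℝ) 1) t ∧
    HasDerivWithinAt (fun s => γ s 2)
      ((b + p 1 * t + p 2 * t^2 + p 3 * t^3) * γ t 0) (Icc (0:ℝ) 1) t ∧
    HasDerivWithinAt (fun s => γ s 3)
      ((1/2) * (b + p 1 * t + p 2 * t^2 + p 3 * t^3) * (γ t 0)^2) (Icc (0:ℝ) 1) t

/-- The Jacobian matrix of the endpoint map `F(p) = γ_p(1)` at `p = 0`. -/
noncomputable def engelJacobian (a b : ℝ) : Matrix (Fin 4) (Fin 4) ℝ :=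
  !![1/2,     0,       0,        0;
     0,       1/2,     1/3,      1/4;
     b/6,     a/3,     a/4,      a/5;
     a*b/8,   a^2/8,   a^2/10,   a^2/12]

/-- Two functions on `[0,1]` with the same derivative and the same value at `0` agree. -/
lemma eq_of_hasDerivWithinAt_Icc {f g f' : ℝ → ℝ}
    (hf : ∀ t ∈ Icc (0:ℝ) 1, HasDerivWithinAt f (f' t) (Icc (0:ℝ) 1) t)
    (hg : ∀ t ∈ Icc (0:ℝ) 1, HasDerivWithinAt g (f' t) (Icc (0:ℝ) 1) t)
    (h0 : f 0 = g 0) {t : ℝ} (ht : t ∈ Icc (0:ℝ) 1) : f t = g t := by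
  have h := (convex_Icc (0:ℝ) 1).norm_image_sub_le_of_norm_hasDerivWithin_le (C := 0)
    (f := fun s => f s - g s) (f' := fun _ => 0)
    (fun s hs => ((hf s hs).sub (hg s hs)).congr_deriv (sub_self _)) (by simp)
    (left_mem_Icc.2 zero_le_one) ht
  simp only [h0, sub_self, sub_zero, zero_mul, norm_le_zero_iff] at h
  exact sub_eq_zero.1 h

lemma hasDerivAt_polynomial_eight (e₁ e₂ e₃ e₄ e₅ e₆ e₇ e₈ t : ℝ) :
    HasDerivAt (fun s : ℝ => e₁ * s + e₂ * s^2 + e₃ * s^3 + e₄ * s^4 + e₅ * s^5 + e₆ * s^6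
        + e₇ * s^7 + e₈ * s^8)
      (e₁ + 2 * e₂ * t + 3 * e₃ * t^2 + 4 * e₄ * t^3 + 5 * e₅ * t^4 + 6 * e₆ * t^5
        + 7 * e₇ * t^6 + 8 * e₈ * t^7) t := by
  have h (n : ℕ) (e : ℝ) := (hasDerivAt_pow n t).const_mul e
  refine HasDerivAt.congr_deriv (((((((((hasDerivAt_id t).const_mul e₁).add (h 2 e₂)).add (h 3 e₃)).add
    (h 4 e₄)).add (h 5 e₅)).add (h 6 e₆)).add (h 7 e₇)).add (h 8 e₈)) ?_
  push_cast
  ring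

/-- If the derivative of `f` on `[0,1]` is a polynomial of degree at most `7` and `f 0 = 0`, then
`f` is the corresponding antiderivative. -/
lemma eq_antideriv_of_hasDerivWithinAt_Icc {f f' : ℝ → ℝ} (e₁ e₂ e₃ e₄ e₅ e₆ e₇ e₈ : ℝ)
    (hf : ∀ t ∈ Icc (0:ℝ) 1, HasDerivWithinAt f (f' t) (Icc (0:ℝ) 1) t) (h0 : f 0 = 0)
    (hf' : ∀ t ∈ Icc (0:ℝ) 1, f' t = e₁ + 2 * e₂ * t + 3 * e₃ * t^2 + 4 * e₄ * t^3
      + 5 * e₅ * t^4 + 6 * e₆ * t^5 + 7 * e₇ * t^6 + 8 * e₈ * t^7)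
    {t : ℝ} (ht : t ∈ Icc (0:ℝ) 1) :
    f t = e₁ * t + e₂ * t^2 + e₃ * t^3 + e₄ * t^4 + e₅ * t^5 + e₆ * t^6
        + e₇ * t^7 + e₈ * t^8 :=
  eq_of_hasDerivWithinAt_Icc hf
    (fun s hs => hf' s hs ▸ (hasDerivAt_polynomial_eight e₁ e₂ e₃ e₄ e₅ e₆ e₇ e₈ s).hasDerivWithinAt)
    (by simp [h0]) ht

/-- The endpoint map in closed form. -/
lemma IsEngelPolyCurve.endpoint {a b : ℝ} {p : Fin 4 → ℝ} {γ : ℝ → Fin 4 → ℝ}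
    (h : IsEngelPolyCurve a b p γ) :
    γ 1 0 = a + 1/2 * p 0 ∧
    γ 1 1 = b + 1/2 * p 1 + 1/3 * p 2 + 1/4 * p 3 ∧
    γ 1 2 = a * b / 2 + a/3 * p 1 + a/4 * p 2 + a/5 * p 3
      + p 0 * (b/6 + 1/8 * p 1 + 1/10 * p 2 + 1/12 * p 3) ∧
    γ 1 3 = a^2 * b / 6 + a^2/8 * p 1 + a^2/10 * p 2 + a^2/12 * p 3
      + p 0 * (a*b/8 + a/10 * p 1 + a/12 * p 2 + a/14 * p 3
        + p 0 * (b/40 + 1/48 * p 1 + 1/56 * p 2 + 1/64 * p 3)) := by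
  obtain ⟨h0, hd⟩ := h
  have hx : ∀ t ∈ Icc (0:ℝ) 1, γ t 0 = a * t + p 0 / 2 * t^2 := fun t ht => by
    rw [eq_antideriv_of_hasDerivWithinAt_Icc a (p 0 / 2) 0 0 0 0 0 0 (fun t ht => (hd t ht).1)
      (by simp [h0]) (fun t _ => by ring) ht]
    ring
  have h1 : (1:ℝ) ∈ Icc (0:ℝ) 1 := right_mem_Icc.2 zero_le_one
  refine ⟨?_, ?_, ?_, ?_⟩
  · rw [hx 1 h1]
    ring
  · rw [eq_antideriv_of_hasDerivWithinAt_Icc b (p 1 / 2) (p 2 / 3) (p 3 / 4) 0 0 0 0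
      (fun t ht => (hd t ht).2.1) (by simp [h0]) (fun t _ => by ring) h1]
    ring
  · rw [eq_antideriv_of_hasDerivWithinAt_Icc 0 (a * b / 2) ((a * p 1 + p 0 / 2 * b) / 3)
      ((a * p 2 + p 0 / 2 * p 1) / 4) ((a * p 3 + p 0 / 2 * p 2) / 5) (p 0 / 2 * p 3 / 6) 0 0
      (fun t ht => (hd t ht).2.2.1) (by simp [h0]) (fun t ht => by rw [hx t ht]; ring) h1]
    ring
  · rw [eq_antideriv_of_hasDerivWithinAt_Icc 0 0 (a^2 * b / 6) ((a^2 * p 1 + a * p 0 * b) / 8)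
      ((a^2 * p 2 + a * p 0 * p 1 + p 0 ^ 2 / 4 * b) / 10)
      ((a^2 * p 3 + a * p 0 * p 2 + p 0 ^ 2 / 4 * p 1) / 12)
      ((a * p 0 * p 3 + p 0 ^ 2 / 4 * p 2) / 14) (p 0 ^ 2 / 4 * p 3 / 16)
      (fun t ht => (hd t ht).2.2.2) (by simp [h0]) (fun t ht => by rw [hx t ht]; ring) h1]
    ring

lemma det_engelJacobian (a b : ℝ) : (engelJacobian a b).det = a^3 / 172800 := by
  simp [engelJacobian, Matrix.det_succ_row_zero, Fin.sum_univ_succ, Fin.succAbove]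
  ring

lemma isUnit_engelJacobian_iff (a b : ℝ) : IsUnit (engelJacobian a b) ↔ a ≠ 0 := by
  rw [Matrix.isUnit_iff_isUnit_det, det_engelJacobian, isUnit_iff_ne_zero]
  simp

lemma hasFDerivAt_affine (k l₀ l₁ l₂ l₃ : ℝ) (x : Fin 4 → ℝ) :
    HasFDerivAt (fun p : Fin 4 → ℝ => k + l₀ * p 0 + l₁ * p 1 + l₂ * p 2 + l₃ * p 3)
      (∑ i, ![l₀, l₁, l₂, l₃] i • ContinuousLinearMap.proj (R := ℝ) (φ := fun _ => ℝ) i) x := by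
  have h (i : Fin 4) (l : ℝ) : HasFDerivAt (fun p : Fin 4 → ℝ => l * p i)
      (l • ContinuousLinearMap.proj (R := ℝ) (φ := fun _ => ℝ) i) x :=
    (hasFDerivAt_apply i x).const_mul l
  refine HasFDerivAt.congr_fderiv (((((h 0 l₀).const_add k).add (h 1 l₁)).add (h 2 l₂)).add (h 3 l₃)) ?_
  simp [Fin.sum_univ_four]

/-- Adding `p 0 * R p` to an affine function contributes `R 0` to the `p 0`-coefficient of its
derivative at `0`. -/
lemma hasFDerivAt_affine_add_mul (k l₁ l₂ l₃ : ℝ) {R : (Fin 4 → ℝ) → ℝ}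
    (hR : DifferentiableAt ℝ R 0) :
    HasFDerivAt (fun p : Fin 4 → ℝ => k + l₁ * p 1 + l₂ * p 2 + l₃ * p 3 + p 0 * R p)
      (∑ i, ![R 0, l₁, l₂, l₃] i • ContinuousLinearMap.proj (R := ℝ) (φ := fun _ => ℝ) i) 0 := by
  have h := (hasFDerivAt_affine k 0 l₁ l₂ l₃ 0).add
    ((hasFDerivAt_apply (0 : Fin 4) (0 : Fin 4 → ℝ)).mul hR.hasFDerivAt)
  refine (h.congr_fderiv ?_).congr_of_eventuallyEq (.of_forall fun p => by simp)
  ext v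
  simp [Fin.sum_univ_four]
  ring

/-- The endpoint map `F(p) = γ_p(1)` has polynomial components, satisfies
`F(0) = (a,b,ab/2,a²b/6)`, its Jacobian at `0` is the explicit matrix above,
whose determinant is `a³/172800`; in particular the Jacobian is invertible
iff `a ≠ 0`. -/
theorem engel_endpoint_map_jacobian (a b : ℝ)
    (γ : (Fin 4 → ℝ) → ℝ → Fin 4 → ℝ)
    (hγ : ∀ p, IsEngelPolyCurve a b p (γ p)) :
    (∀ i : Fin 4, ∃ q : MvPolynomial (Fin 4) ℝ,
      ∀ p : Fin 4 → ℝ, γ p 1 i = MvPolynomial.eval p q) ∧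
    γ 0 1 = ![a, b, a * b / 2, a^2 * b / 6] ∧
    HasFDerivAt (fun p => γ p 1)
      (LinearMap.toContinuousLinearMap (Matrix.toLin' (engelJacobian a b))) 0 ∧
    (engelJacobian a b).det = a^3 / 172800 ∧
    (IsUnit (engelJacobian a b) ↔ a ≠ 0) := by
  refine ⟨fun i => ?_, ?_, ?_, det_engelJacobian a b, isUnit_engelJacobian_iff a b⟩
  · let X (i : Fin 4) : MvPolynomial (Fin 4) ℝ := .X i
    let C (r : ℝ) : MvPolynomial (Fin 4) ℝ := .C r
    fin_cases i
    · exact ⟨C a + C (1/2) * X 0, fun p => by simp [X, C, (hγ p).endpoint.1]⟩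
    · exact ⟨C b + C (1/2) * X 1 + C (1/3) * X 2 + C (1/4) * X 3,
        fun p => by simp [X, C, (hγ p).endpoint.2.1]⟩
    · exact ⟨C (a * b / 2) + C (a/3) * X 1 + C (a/4) * X 2 + C (a/5) * X 3
        + X 0 * (C (b/6) + C (1/8) * X 1 + C (1/10) * X 2 + C (1/12) * X 3),
        fun p => (hγ p).endpoint.2.2.1.trans (by simp only [X, C, map_add, map_mul,
          MvPolynomial.eval_X, MvPolynomial.eval_C])⟩
    · exact ⟨C (a^2 * b / 6) + C (a^2/8) * X 1 + C (a^2/10) * X 2 + C (a^2/12) * X 3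
        + X 0 * (C (a*b/8) + C (a/10) * X 1 + C (a/12) * X 2 + C (a/14) * X 3
          + X 0 * (C (b/40) + C (1/48) * X 1 + C (1/56) * X 2 + C (1/64) * X 3)),
        fun p => (hγ p).endpoint.2.2.2.trans (by simp only [X, C, map_add, map_mul,
          MvPolynomial.eval_X, MvPolynomial.eval_C])⟩
  · obtain ⟨h0, h1, h2, h3⟩ := (hγ 0).endpoint
    ext i
    fin_cases i <;> simp [h0, h1, h2, h3]
  · refine hasFDerivAt_pi'.2 fun i => ?_
    fin_cases i
    · refine ((hasFDerivAt_affine a (1/2) 0 0 0 0).congr_fderiv ?_).congr_of_eventuallyEq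
        (.of_forall fun p => (hγ p).endpoint.1.trans (by ring))
      ext v
      simp [engelJacobian, Fin.sum_univ_four, dotProduct]
    · refine ((hasFDerivAt_affine b 0 (1/2) (1/3) (1/4) 0).congr_fderiv ?_).congr_of_eventuallyEq
        (.of_forall fun p => (hγ p).endpoint.2.1.trans (by ring))
      ext v
      simp [engelJacobian, Fin.sum_univ_four, dotProduct]
    · refine ((hasFDerivAt_affine_add_mul (a * b / 2) (a/3) (a/4) (a/5)
        (R := fun p => b/6 + 1/8 * p 1 + 1/10 * p 2 + 1/12 * p 3)
        (by fun_prop)).congr_fderiv ?_).congr_of_eventuallyEq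
        (.of_forall fun p => (hγ p).endpoint.2.2.1)
      ext v
      simp [engelJacobian, Fin.sum_univ_four, dotProduct]
    · refine ((hasFDerivAt_affine_add_mul (a^2 * b / 6) (a^2/8) (a^2/10) (a^2/12)
        (R := fun p => a*b/8 + a/10 * p 1 + a/12 * p 2 + a/14 * p 3
          + p 0 * (b/40 + 1/48 * p 1 + 1/56 * p 2 + 1/64 * p 3))
        (by fun_prop)).congr_fderiv ?_).congr_of_eventuallyEq
        (.of_forall fun p => (hγ p).endpoint.2.2.2)
      ext v
      simp [engelJacobian, Fin.sum_univ_four, dotProduct]
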